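/- arXiv:1802.04366 — 2 statements merged into one kernel-verified Lean document; each statement's English description precedes it below -/
import Mathlib

section
/- Let g ∈ ℝ^d with g ≠ 0, let R v = v - 2 (⟨v, g⟩ / ‖g‖²) g, and let ψ_d be the standard Gaussian density on ℝ^d. Then for every bounded measurable f : ℝ^d → ℝ, ∫_{ℝ^d} max{0, ⟨v, g⟩} f(R v) ψ_d(v) dv = ∫_{ℝ^d} max{0, -⟨v, g⟩} f(v) ψ_d(v) dv, and hence ∫ max{0, ⟨v,g⟩} (f(R v) - f(v)) ψ_d(v) dv = -∫ ⟨v, g⟩ f(v) ψ_d(v) dv. -/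
open scoped InnerProductSpace
open MeasureTheory

/-- The standard Gaussian density on `ℝ^d`. -/
noncomputable def gaussDensity (d : ℕ) (v : EuclideanSpace ℝ (Fin d)) : ℝ :=
  (2 * Real.pi) ^ (-(d : ℝ) / 2) * Real.exp (-‖v‖ ^ 2 / 2)

theorem integrable_exp_neg_mul_norm_sq {d : ℕ} {b : ℝ} (hb : 0 < b) :
    Integrable fun v : EuclideanSpace ℝ (Fin d) => Real.exp (-b * ‖v‖ ^ 2) := by
  have h := (GaussianFourier.integrable_cexp_neg_mul_sq_norm_add (b := (b : ℂ)) (by simpa) 0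
    (0 : EuclideanSpace ℝ (Fin d))).norm
  refine h.congr (Filter.Eventually.of_forall fun v => ?_)
  simp only [Complex.norm_exp, zero_mul, add_zero]
  norm_cast

theorem continuous_gaussDensity (d : ℕ) : Continuous (gaussDensity d) := by
  unfold gaussDensity
  fun_prop

theorem gaussDensity_nonneg (d : ℕ) (v : EuclideanSpace ℝ (Fin d)) : 0 ≤ gaussDensity d v := by
  unfold gaussDensity
  positivity

theorem integrable_norm_mul_gaussDensity (d : ℕ) :
    Integrable fun v : EuclideanSpace ℝ (Fin d) => ‖v‖ * gaussDensity d v := by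
  refine ((integrable_exp_neg_mul_norm_sq (d := d) (b := 1 / 4) (by norm_num)).const_mul
    ((2 * Real.pi) ^ (-(d : ℝ) / 2))).mono'
    (continuous_norm.mul (continuous_gaussDensity d)).aestronglyMeasurable
    (Filter.Eventually.of_forall fun v => ?_)
  rw [Real.norm_of_nonneg (mul_nonneg (norm_nonneg v) (gaussDensity_nonneg d v))]
  have h : ‖v‖ ≤ Real.exp (‖v‖ ^ 2 / 4) := by
    nlinarith [Real.add_one_le_exp (‖v‖ ^ 2 / 4), sq_nonneg (‖v‖ - 2)]
  calc ‖v‖ * gaussDensity d v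
      = (2 * Real.pi) ^ (-(d : ℝ) / 2) * (‖v‖ * Real.exp (-‖v‖ ^ 2 / 2)) := by
        unfold gaussDensity
        ring
    _ ≤ (2 * Real.pi) ^ (-(d : ℝ) / 2) *
          (Real.exp (‖v‖ ^ 2 / 4) * Real.exp (-‖v‖ ^ 2 / 2)) := by gcongr
    _ = (2 * Real.pi) ^ (-(d : ℝ) / 2) * Real.exp (-(1 / 4) * ‖v‖ ^ 2) := by
        rw [← Real.exp_add]
        ring_nf

/-- A function of at most linear growth times a bounded function is integrable against the
standard Gaussian density. -/
theorem integrable_mul_mul_gaussDensity {d : ℕ} {k h : EuclideanSpace ℝ (Fin d) → ℝ} {K C : ℝ}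
    (hk : Measurable k) (hkK : ∀ v, |k v| ≤ K * ‖v‖) (hh : Measurable h) (hhC : ∀ v, |h v| ≤ C) :
    Integrable fun v => k v * h v * gaussDensity d v := by
  refine ((integrable_norm_mul_gaussDensity d).const_mul (K * C)).mono'
    ((hk.mul hh).mul (continuous_gaussDensity d).measurable).aestronglyMeasurable
    (Filter.Eventually.of_forall fun v => ?_)
  rw [Real.norm_eq_abs, abs_mul, abs_mul, abs_of_nonneg (gaussDensity_nonneg d v)]
  calc |k v| * |h v| * gaussDensity d v ≤ (K * ‖v‖) * C * gaussDensity d v :=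
        mul_le_mul_of_nonneg_right (mul_le_mul (hkK v) (hhC v) (abs_nonneg _)
          ((abs_nonneg _).trans (hkK v))) (gaussDensity_nonneg d v)
    _ = K * C * (‖v‖ * gaussDensity d v) := by ring

/-- The change-of-variables step `u = R v` in the proof that the Bouncy Hybrid
Sampler preserves the target distribution. -/
theorem stmt_3 {d : ℕ} (g : EuclideanSpace ℝ (Fin d)) (hg : g ≠ 0)
    (R : EuclideanSpace ℝ (Fin d) → EuclideanSpace ℝ (Fin d))
    (hR : ∀ v, R v = v - (2 * ⟪v, g⟫_ℝ / ‖g‖ ^ 2) • g)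
    (f : EuclideanSpace ℝ (Fin d) → ℝ) (hf : Measurable f)
    (hfb : ∃ C, ∀ v, |f v| ≤ C) :
    (∫ v, max 0 ⟪v, g⟫_ℝ * f (R v) * gaussDensity d v
        = ∫ v, max 0 (-⟪v, g⟫_ℝ) * f v * gaussDensity d v) ∧
    (∫ v, max 0 ⟪v, g⟫_ℝ * (f (R v) - f v) * gaussDensity d v
        = -∫ v, ⟪v, g⟫_ℝ * f v * gaussDensity d v) := by
  have hRe : R = (ℝ ∙ g)ᗮ.reflection := by
    funext v
    rw [hR, Submodule.reflection_orthogonal_apply, Submodule.reflection_singleton_apply,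
      real_inner_comm]
    simp only [neg_sub, RCLike.ofReal_real_eq_id, id, ← Nat.cast_smul_eq_nsmul ℝ, smul_smul]
    norm_num [mul_div_assoc]
  have hRm : Measurable R := hRe ▸ (ℝ ∙ g)ᗮ.reflection.continuous.measurable
  have hRg : ∀ v, ⟪R v, g⟫_ℝ = -⟪v, g⟫_ℝ := fun v => by
    have hg' : ‖g‖ ≠ 0 := norm_ne_zero_iff.mpr hg
    rw [hR, inner_sub_left, real_inner_smul_left, real_inner_self_eq_norm_sq]
    field_simp
    ring
  have hRγ : ∀ v, gaussDensity d (R v) = gaussDensity d v := fun v => by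
    simp only [gaussDensity, hRe, LinearIsometryEquiv.norm_map]
  have bounce : ∫ v, max 0 ⟪v, g⟫_ℝ * f (R v) * gaussDensity d v
      = ∫ v, max 0 (-⟪v, g⟫_ℝ) * f v * gaussDensity d v := by
    have h := (hRe ▸ (ℝ ∙ g)ᗮ.reflection.measurePreserving : MeasurePreserving R).integral_comp
      (hRe ▸ (ℝ ∙ g)ᗮ.reflection.toHomeomorph.measurableEmbedding)
      (fun v => max 0 (-⟪v, g⟫_ℝ) * f v * gaussDensity d v)
    simpa only [hRg, hRγ, neg_neg] using h
  refine ⟨bounce, ?_⟩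
  obtain ⟨C, hC⟩ := hfb
  have hinner : ∀ v, |⟪v, g⟫_ℝ| ≤ ‖g‖ * ‖v‖ := fun v =>
    (abs_real_inner_le_norm v g).trans_eq (mul_comm _ _)
  have hmax : ∀ v, |max 0 ⟪v, g⟫_ℝ| ≤ ‖g‖ * ‖v‖ := fun v => by
    rw [abs_of_nonneg (le_max_left _ _)]
    exact max_le (by positivity) ((le_abs_self _).trans (hinner v))
  have hmax' : ∀ v, |max 0 (-⟪v, g⟫_ℝ)| ≤ ‖g‖ * ‖v‖ := fun v => by
    rw [abs_of_nonneg (le_max_left _ _)]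
    exact max_le (by positivity) ((neg_le_abs _).trans (hinner v))
  have hfR := integrable_mul_mul_gaussDensity (by fun_prop) hmax (hf.comp hRm) fun v => hC (R v)
  have hf₁ := integrable_mul_mul_gaussDensity (by fun_prop) hmax hf hC
  have hf₂ := integrable_mul_mul_gaussDensity (by fun_prop) hmax' hf hC
  calc ∫ v, max 0 ⟪v, g⟫_ℝ * (f (R v) - f v) * gaussDensity d v
      = (∫ v, max 0 ⟪v, g⟫_ℝ * f (R v) * gaussDensity d v)
          - ∫ v, max 0 ⟪v, g⟫_ℝ * f v * gaussDensity d v := by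
        refine Eq.trans ?_ (integral_sub hfR hf₁)
        simp only [mul_sub, sub_mul]
    _ = -∫ v, ⟪v, g⟫_ℝ * f v * gaussDensity d v := by
        rw [bounce, ← integral_sub hf₂ hf₁, ← integral_neg]
        congr 1 with v
        rw [← sub_mul, ← sub_mul, ← neg_mul, ← neg_mul]
        congr 2
        rcases le_total 0 ⟪v, g⟫_ℝ with h | h <;> simp [h]
end

section
/- (Invariant density of the Bouncy Hybrid Sampler.) Let U : ℝ^d → ℝ be continuously differentiable with ∫ e^{-U(x)} dx < ∞, let g : ℝ^d → ℝ^d be continuous with g(x) ≠ 0 for all x, let λ₀ ≥ 0, and for each x let R(x) v = v - 2 (⟨v, g(x)⟩ / ‖g(x)‖²) g(x). Then for every smooth compactly supported f : ℝ^d × ℝ^d → ℝ, ∫∫ [ ⟨∇_x f(x,v), v⟩ + ⟨∇_v f(x,v), -∇U(x) + g(x)⟩ + max{0, ⟨v, g(x)⟩} (f(x, R(x) v) - f(x,v)) + λ₀ ( ∫ f(x, v') ψ_d(v') dv' - f(x,v) ) ] e^{-U(x)} ψ_d(v) dx dv = 0. -/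
open scoped InnerProductSpace
open MeasureTheory

section Slices

variable {E F : Type*} [NormedAddCommGroup E] [NormedAddCommGroup F]

theorem HasCompactSupport.comp_prodMk_left {f : E × F → ℝ} (hf : HasCompactSupport f) (x : E) :
    HasCompactSupport fun v => f (x, v) :=
  HasCompactSupport.intro (hf.image continuous_snd) fun v hv =>
    image_eq_zero_of_notMem_tsupport fun h => hv ⟨(x, v), h, rfl⟩

theorem HasCompactSupport.comp_prodMk_right {f : E × F → ℝ} (hf : HasCompactSupport f) (v : F) :
    HasCompactSupport fun x => f (x, v) :=
  HasCompactSupport.intro (hf.image continuous_fst) fun x hx =>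
    image_eq_zero_of_notMem_tsupport fun h => hx ⟨(x, v), h, rfl⟩

variable [NormedSpace ℝ E]

theorem fderiv_comp_prodMk_right [NormedSpace ℝ F] {f : E × F → ℝ} {x : E} {v : F}
    (hf : DifferentiableAt ℝ f (x, v)) (w : E) :
    fderiv ℝ (fun y => f (y, v)) x w = fderiv ℝ f (x, v) (w, 0) := by
  have h : HasFDerivAt (fun y => f (y, v)) _ x :=
    hf.hasFDerivAt.comp x (hasFDerivAt_prodMk_left x v)
  rw [h.fderiv]
  simp

/-- Integration by parts against a compactly supported `C¹` function. -/
theorem integral_fderiv_mul_eq_neg_of_hasCompactSupport [MeasurableSpace E] [BorelSpace E]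
    [FiniteDimensional ℝ E] {μ : Measure E} [μ.IsAddHaarMeasure]
    {p q : E → ℝ} (hp : ContDiff ℝ 1 p) (hpc : HasCompactSupport p) (hq : ContDiff ℝ 1 q) (v : E) :
    ∫ x, fderiv ℝ p x v * q x ∂μ = -∫ x, p x * fderiv ℝ q x v ∂μ := by
  have hp' : Continuous fun x => fderiv ℝ p x v :=
    (hp.continuous_fderiv one_ne_zero).clm_apply continuous_const
  have hq' : Continuous fun x => fderiv ℝ q x v :=
    (hq.continuous_fderiv one_ne_zero).clm_apply continuous_const
  rw [integral_mul_fderiv_eq_neg_fderiv_mul_of_integrable, neg_neg]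
  · exact (hp'.mul hq.continuous).integrable_of_hasCompactSupport (hpc.fderiv_apply ℝ v).mul_right
  · exact (hp.continuous.mul hq').integrable_of_hasCompactSupport hpc.mul_right
  · exact (hp.continuous.mul hq.continuous).integrable_of_hasCompactSupport hpc.mul_right
  · exact fun x _ => hp.differentiable one_ne_zero x
  · exact fun x _ => hq.differentiable one_ne_zero x

end Slices

section Gaussian

variable {d : ℕ}

theorem contDiff_gaussDensity {n : WithTop ℕ∞} : ContDiff ℝ n (gaussDensity d) :=
  contDiff_const.mul (((contDiff_norm_sq ℝ).neg.div_const 2).exp)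

theorem fderiv_gaussDensity (v w : EuclideanSpace ℝ (Fin d)) :
    fderiv ℝ (gaussDensity d) v w = -⟪v, w⟫_ℝ * gaussDensity d v := by
  have h : HasFDerivAt (gaussDensity d) _ v :=
    ((((hasStrictFDerivAt_norm_sq v).hasFDerivAt.neg).mul_const (2⁻¹ : ℝ)).exp).const_mul
      ((2 * Real.pi) ^ (-(d : ℝ) / 2))
  rw [h.fderiv]
  simp [gaussDensity, div_eq_mul_inv]
  ring

theorem integral_gaussDensity : ∫ v, gaussDensity d v = 1 := by
  have h := GaussianFourier.integral_rexp_neg_mul_sq_norm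
    (V := EuclideanSpace ℝ (Fin d)) (b := 1 / 2) (by norm_num)
  have h2 : (fun v => gaussDensity d v) = fun v : EuclideanSpace ℝ (Fin d) =>
      (2 * Real.pi) ^ (-(d : ℝ) / 2) * Real.exp (-(1 / 2) * ‖v‖ ^ 2) := by
    ext v
    rw [gaussDensity]
    ring_nf
  rw [h2, integral_const_mul, h, finrank_euclideanSpace_fin,
    show Real.pi / (1 / 2) = 2 * Real.pi by ring, ← Real.rpow_add (by positivity), neg_div,
    neg_add_cancel, Real.rpow_zero]

theorem integrable_gaussDensity : Integrable (gaussDensity d) :=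
  Integrable.of_integral_ne_zero (by rw [integral_gaussDensity]; exact one_ne_zero)

end Gaussian

section Reflection

variable {E : Type*} [NormedAddCommGroup E] [InnerProductSpace ℝ E]

theorem reflection_orthogonal_singleton_apply (u v : E) :
    (ℝ ∙ u)ᗮ.reflection v = v - (2 * ⟪v, u⟫_ℝ / ‖u‖ ^ 2) • u := by
  rw [Submodule.reflection_orthogonal_apply, Submodule.reflection_singleton_apply, neg_sub,
    real_inner_comm, mul_div_assoc, mul_smul, two_smul ℝ, two_smul ℕ]
  rfl

theorem inner_reflection_orthogonal_singleton (u v : E) :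
    ⟪(ℝ ∙ u)ᗮ.reflection v, u⟫_ℝ = -⟪v, u⟫_ℝ := by
  rw [reflection_orthogonal_singleton_apply, inner_sub_left, real_inner_smul_left,
    real_inner_self_eq_norm_sq]
  rcases eq_or_ne u 0 with rfl | hu
  · simp
  · have := norm_ne_zero_iff.2 hu
    field_simp
    ring

/-- The bounce operator at rate `max 0 ⟪v, u⟫` tested against a rotation invariant weight. -/
theorem integral_bounce_mul [FiniteDimensional ℝ E] [MeasurableSpace E] [BorelSpace E]
    {h φ : E → ℝ} (hh : Continuous h) (hc : HasCompactSupport h) (hφ : Continuous φ) (u : E)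
    (hφu : ∀ v, φ ((ℝ ∙ u)ᗮ.reflection v) = φ v) :
    Integrable (fun v => max 0 ⟪v, u⟫_ℝ * (h ((ℝ ∙ u)ᗮ.reflection v) - h v) * φ v) ∧
    ∫ v, max 0 ⟪v, u⟫_ℝ * (h ((ℝ ∙ u)ᗮ.reflection v) - h v) * φ v
      = -∫ v, h v * (⟪v, u⟫_ℝ * φ v) := by
  set S := (ℝ ∙ u)ᗮ.reflection with hS
  have hSS (v : E) : S (S v) = v := Submodule.reflection_reflection _ v
  have hi (q : E → ℝ) (hq : Continuous q) : Integrable fun v => h v * q v :=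
    (hh.mul hq).integrable_of_hasCompactSupport hc.mul_right
  have hplus := hi (fun v => max 0 ⟪v, u⟫_ℝ * φ v) (by fun_prop)
  have hminus := hi (fun v => max 0 (-⟪v, u⟫_ℝ) * φ v) (by fun_prop)
  have hcomp (v : E) : h (S v) * (max 0 (-⟪S v, u⟫_ℝ) * φ (S v))
      = max 0 ⟪v, u⟫_ℝ * h (S v) * φ v := by
    rw [hφu, hS, inner_reflection_orthogonal_singleton, neg_neg]
    ring
  have hmS : Integrable fun v => max 0 ⟪v, u⟫_ℝ * h (S v) * φ v := by
    simpa only [Function.comp_def, hcomp] using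
      S.measurePreserving.integrable_comp_of_integrable hminus
  have hmI : ∫ v, max 0 ⟪v, u⟫_ℝ * h (S v) * φ v = ∫ v, h v * (max 0 (-⟪v, u⟫_ℝ) * φ v) := by
    simp only [← hcomp]
    exact S.measurePreserving.integral_comp S.toMeasurableEquiv.measurableEmbedding
      (fun v => h v * (max 0 (-⟪v, u⟫_ℝ) * φ v))
  have hsplit : (fun v => max 0 ⟪v, u⟫_ℝ * (h (S v) - h v) * φ v) = fun v =>
      max 0 ⟪v, u⟫_ℝ * h (S v) * φ v - h v * (max 0 ⟪v, u⟫_ℝ * φ v) := by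
    ext v
    ring
  rw [hsplit]
  refine ⟨hmS.sub hplus, ?_⟩
  rw [integral_sub hmS hplus, hmI, ← integral_sub hminus hplus, ← integral_neg]
  congr 1 with v
  rcases le_total 0 ⟪v, u⟫_ℝ with hv | hv
  · rw [max_eq_right hv, max_eq_left (neg_nonpos.2 hv)]
    ring
  · rw [max_eq_left hv, max_eq_right (neg_nonneg.2 hv)]
    ring

end Reflection

theorem gaussDensity_map_linearIsometry {d : ℕ}
    (S : EuclideanSpace ℝ (Fin d) ≃ₗᵢ[ℝ] EuclideanSpace ℝ (Fin d))
    (v : EuclideanSpace ℝ (Fin d)) : gaussDensity d (S v) = gaussDensity d v := by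
  simp [gaussDensity]

/-- Averaging over the velocity: the bounces, the refreshments and the drift along `u` cancel, and
only the Hamiltonian part of the generator remains. -/
theorem integral_velocity_generator {d : ℕ} {h ℓ : EuclideanSpace ℝ (Fin d) → ℝ}
    (hh : ContDiff ℝ 1 h) (hc : HasCompactSupport h) (hℓ : Continuous ℓ)
    (hℓc : HasCompactSupport ℓ) (w u : EuclideanSpace ℝ (Fin d)) (lam e : ℝ) :
    ∫ v, (ℓ v + fderiv ℝ h v (-w + u)
        + max 0 ⟪v, u⟫_ℝ * (h ((ℝ ∙ u)ᗮ.reflection v) - h v)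
        + lam * ((∫ v', h v' * gaussDensity d v') - h v)) * (e * gaussDensity d v)
      = ∫ v, (ℓ v * e - h v * (e * ⟪w, v⟫_ℝ)) * gaussDensity d v := by
  have hφ : Continuous (gaussDensity d) := (contDiff_gaussDensity (n := 0)).continuous
  have hi (q : EuclideanSpace ℝ (Fin d) → ℝ) (hq : Continuous q) :
      Integrable fun v => h v * q v :=
    (hh.continuous.mul hq).integrable_of_hasCompactSupport hc.mul_right
  have hA : Integrable fun v => ℓ v * gaussDensity d v :=
    (hℓ.mul hφ).integrable_of_hasCompactSupport hℓc.mul_right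
  have hB : Integrable fun v => fderiv ℝ h v (-w + u) * gaussDensity d v :=
    (((hh.continuous_fderiv one_ne_zero).clm_apply
      continuous_const).mul hφ).integrable_of_hasCompactSupport
        (hc.fderiv_apply ℝ (-w + u)).mul_right
  obtain ⟨hC, hCI⟩ := integral_bounce_mul hh.continuous hc hφ u
    (gaussDensity_map_linearIsometry _)
  have hφh := hi (gaussDensity d) hφ
  set c := ∫ v', h v' * gaussDensity d v'
  have hD : Integrable fun v => c * gaussDensity d v - h v * gaussDensity d v :=
    (integrable_gaussDensity.const_mul c).sub hφh
  have hDI : ∫ v, (c * gaussDensity d v - h v * gaussDensity d v) = 0 := by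
    rw [integral_sub (integrable_gaussDensity.const_mul c) hφh, integral_const_mul,
      integral_gaussDensity, mul_one, sub_self]
  have hw := hi (fun v => ⟪w, v⟫_ℝ * gaussDensity d v) (by fun_prop)
  have hu := hi (fun v => ⟪v, u⟫_ℝ * gaussDensity d v) (by fun_prop)
  have hBI : ∫ v, fderiv ℝ h v (-w + u) * gaussDensity d v
      = (∫ v, h v * (⟪v, u⟫_ℝ * gaussDensity d v))
        - ∫ v, h v * (⟪w, v⟫_ℝ * gaussDensity d v) := by
    rw [integral_fderiv_mul_eq_neg_of_hasCompactSupport hh hc contDiff_gaussDensity,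
      ← integral_neg, ← integral_sub hu hw]
    congr 1 with v
    rw [fderiv_gaussDensity, inner_add_right, inner_neg_right, real_inner_comm v w]
    ring
  calc
    _ = ∫ v, e * (((ℓ v * gaussDensity d v + fderiv ℝ h v (-w + u) * gaussDensity d v)
        + max 0 ⟪v, u⟫_ℝ * (h ((ℝ ∙ u)ᗮ.reflection v) - h v) * gaussDensity d v)
        + lam * (c * gaussDensity d v - h v * gaussDensity d v)) := by
      congr 1 with v
      ring
    _ = e * ((∫ v, ℓ v * gaussDensity d v) - ∫ v, h v * (⟪w, v⟫_ℝ * gaussDensity d v)) := by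
      rw [integral_const_mul, integral_add ((hA.fun_add hB).fun_add hC) (hD.const_mul lam),
        integral_add (hA.fun_add hB) hC, integral_add hA hB, integral_const_mul, hDI, hCI, hBI]
      ring
    _ = _ := by
      rw [← integral_sub hA hw, ← integral_const_mul]
      congr 1 with v
      ring

/-- The Hamiltonian part of the generator has zero mean against a product weight `e^{-U} φ`. -/
theorem integral_integral_hamiltonian {E : Type*} [NormedAddCommGroup E] [NormedSpace ℝ E]
    [FiniteDimensional ℝ E] [MeasurableSpace E] [BorelSpace E] {μ : Measure E}
    [μ.IsAddHaarMeasure] {U φ : E → ℝ} (hU : ContDiff ℝ 1 U) (hφ : Continuous φ)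
    {f : E × E → ℝ} (hf : ContDiff ℝ 1 f) (hfc : HasCompactSupport f) :
    ∫ x, ∫ v, (fderiv ℝ f (x, v) (v, 0) * Real.exp (-U x)
      - f (x, v) * (Real.exp (-U x) * fderiv ℝ U x v)) * φ v ∂μ ∂μ = 0 := by
  have hf' : Continuous fun z : E × E => fderiv ℝ f z (z.2, 0) :=
    (hf.continuous_fderiv one_ne_zero).clm_apply (by fun_prop)
  have hU' : Continuous fun z : E × E => fderiv ℝ U z.1 z.2 :=
    ((hU.continuous_fderiv one_ne_zero).comp continuous_fst).clm_apply continuous_snd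
  have hUc := hU.continuous
  have hfcont := hf.continuous
  have hexp (x w : E) : fderiv ℝ (fun x => Real.exp (-U x)) x w
      = -(Real.exp (-U x) * fderiv ℝ U x w) := by
    rw [((hU.differentiable one_ne_zero x).hasFDerivAt.fun_neg.exp).fderiv]
    simp
  have hint : Integrable (fun z : E × E => (fderiv ℝ f z (z.2, 0) * Real.exp (-U z.1)
      - f z * (Real.exp (-U z.1) * fderiv ℝ U z.1 z.2)) * φ z.2) (μ.prod μ) := by
    refine Continuous.integrable_of_hasCompactSupport (by fun_prop) ?_
    refine HasCompactSupport.intro hfc fun z hz => ?_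
    rw [image_eq_zero_of_notMem_tsupport hz,
      image_eq_zero_of_notMem_tsupport fun h => hz (tsupport_fderiv_subset ℝ h)]
    simp
  rw [integral_integral_swap hint]
  refine integral_eq_zero_of_ae (.of_forall fun v => ?_)
  have hfv : ContDiff ℝ 1 fun x => f (x, v) := hf.comp (contDiff_id.prodMk contDiff_const)
  have hfvc := hfc.comp_prodMk_right v
  have hibp := integral_fderiv_mul_eq_neg_of_hasCompactSupport (μ := μ) hfv hfvc
    (hU.neg.exp) v
  simp only [hexp, fderiv_comp_prodMk_right (hf.differentiable one_ne_zero _), mul_neg,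
    integral_neg, neg_neg] at hibp
  simp only [Pi.zero_apply]
  rw [integral_mul_const, integral_sub, hibp, sub_self, zero_mul]
  · refine Continuous.integrable_of_hasCompactSupport
      ((hf'.comp (Continuous.prodMk_left v)).mul (by fun_prop)) (HasCompactSupport.mul_right ?_)
    simpa only [fderiv_comp_prodMk_right (hf.differentiable one_ne_zero _)] using
      hfvc.fderiv_apply ℝ v
  · exact Continuous.integrable_of_hasCompactSupport (hfv.continuous.mul
      (hUc.neg.rexp.mul (hU'.comp (Continuous.prodMk_left v)))) hfvc.mul_right

/-- Invariant density of the Bouncy Hybrid Sampler: the integral of the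
infinitesimal generator against `ρ(x,v) ∝ e^{-U(x)} ψ_d(v)` vanishes. -/
theorem stmt_4 {d : ℕ} (U : EuclideanSpace ℝ (Fin d) → ℝ) (hU : ContDiff ℝ 1 U)
    (hUint : Integrable (fun x => Real.exp (-U x)))
    (g : EuclideanSpace ℝ (Fin d) → EuclideanSpace ℝ (Fin d)) (hg : Continuous g)
    (hg0 : ∀ x, g x ≠ 0)
    (lam0 : ℝ) (hlam0 : 0 ≤ lam0)
    (R : EuclideanSpace ℝ (Fin d) → EuclideanSpace ℝ (Fin d) → EuclideanSpace ℝ (Fin d))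
    (hR : ∀ x v, R x v = v - (2 * ⟪v, g x⟫_ℝ / ‖g x‖ ^ 2) • g x)
    (f : EuclideanSpace ℝ (Fin d) × EuclideanSpace ℝ (Fin d) → ℝ)
    (hf : ContDiff ℝ (⊤ : ℕ∞) f) (hfc : HasCompactSupport f) :
    ∫ x, ∫ v,
        (⟪gradient (fun y => f (y, v)) x, v⟫_ℝ
          + ⟪gradient (fun w => f (x, w)) v, -gradient U x + g x⟫_ℝ
          + max 0 ⟪v, g x⟫_ℝ * (f (x, R x v) - f (x, v))
          + lam0 * ((∫ v', f (x, v') * gaussDensity d v') - f (x, v)))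
        * (Real.exp (-U x) * gaussDensity d v) = 0 := by
  have hf1 : ContDiff ℝ 1 f := hf.of_le (by exact_mod_cast le_top)
  have hfd : Differentiable ℝ f := hf1.differentiable one_ne_zero
  refine Eq.trans ?_ (integral_integral_hamiltonian (μ := volume) hU
    (contDiff_gaussDensity (d := d) (n := 0)).continuous hf1 hfc)
  congr 1 with x
  have hℓ : Continuous fun v => fderiv ℝ f (x, v) (v, 0) :=
    ((hf1.continuous_fderiv one_ne_zero).comp (Continuous.prodMk_right x)).clm_apply (by fun_prop)
  have hℓc : HasCompactSupport fun v => fderiv ℝ f (x, v) (v, 0) := by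
    refine HasCompactSupport.intro ((hfc.fderiv ℝ).image continuous_snd) fun v hv => ?_
    rw [image_eq_zero_of_notMem_tsupport fun h => hv ⟨(x, v), h, rfl⟩]
    rfl
  have hfx : ContDiff ℝ 1 fun v => f (x, v) := hf1.comp (contDiff_const.prodMk contDiff_id)
  have := integral_velocity_generator hfx (hfc.comp_prodMk_left x) hℓ hℓc (gradient U x) (g x)
    lam0 (Real.exp (-U x))
  simpa only [inner_gradient_left, fderiv_comp_prodMk_right (hfd _),
    reflection_orthogonal_singleton_apply, ← hR] using this
end
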